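/- Let k be a field, V a finite set, m a natural number, and F a downward-closed family of subsets of V with V ∉ F. Let I(F) be the ideal of k[x_v : v ∈ V] generated by the squarefree monomials x^{V∖A} = ∏_{v ∈ V∖A} x_v for A ∈ F. Then the height of I(F) is at least m+1 if and only if every subset A ⊆ V with |A| ≤ m belongs to F. (This is the combinatorial content of the statement: the fan of a simplicial projective toric variety is m-neighborly if and only if, in Cox's GIT description, the unstable locus has codimension at least m+1.) -/

import Mathlib

open MvPolynomial in
/-- The substitution killing the variables in `A`. -/
noncomputable def killVars (k : Type*) [Field k] {V : Type*} [DecidableEq V] (A : Finset V) :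
    MvPolynomial V k →ₐ[k] MvPolynomial V k :=
  aeval (fun v => if v ∈ A then 0 else X v)

/-- The prime ideal generated by the variables in `A`. -/
noncomputable def varPrime (k : Type*) [Field k] {V : Type*} [DecidableEq V] (A : Finset V) :
    Ideal (MvPolynomial V k) := RingHom.ker (killVars k A)

instance varPrime_isPrime (k : Type*) [Field k] {V : Type*} [DecidableEq V] (A : Finset V) :
    (varPrime k A).IsPrime := RingHom.ker_isPrime _

theorem X_mem_varPrime {k : Type*} [Field k] {V : Type*} [DecidableEq V] (A : Finset V) (v : V) :
    (MvPolynomial.X v : MvPolynomial V k) ∈ varPrime k A ↔ v ∈ A := by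
  by_cases h : v ∈ A <;> simp [varPrime, killVars, RingHom.mem_ker, h]

theorem varPrime_eq_span {k : Type*} [Field k] {V : Type*} [DecidableEq V] (A : Finset V) :
    varPrime k A = Ideal.span (MvPolynomial.X '' (A : Set V)) := by
  apply le_antisymm
  · intro p hp
    set J : Ideal (MvPolynomial V k) := Ideal.span (MvPolynomial.X '' (A : Set V)) with hJ
    have key : (Ideal.Quotient.mkₐ k J).comp (killVars k A) = Ideal.Quotient.mkₐ k J := by
      apply MvPolynomial.algHom_ext
      intro v
      by_cases h : v ∈ A
      · have hm : (MvPolynomial.X v : MvPolynomial V k) ∈ J :=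
          Ideal.subset_span ⟨v, by simpa using h, rfl⟩
        have := Ideal.Quotient.eq_zero_iff_mem.2 hm
        simp [killVars, h, this]
      · simp [killVars, h]
    have h0 : killVars k A p = 0 := hp
    have h1 := DFunLike.congr_fun key p
    rw [AlgHom.comp_apply, h0, map_zero] at h1
    exact Ideal.Quotient.eq_zero_iff_mem.1 h1.symm
  · rw [Ideal.span_le]
    rintro _ ⟨v, hv, rfl⟩
    exact (X_mem_varPrime A v).2 (by simpa using hv)

theorem varPrime_le {k : Type*} [Field k] {V : Type*} [DecidableEq V] (A : Finset V)
    (P : Ideal (MvPolynomial V k)) (h : ∀ v ∈ A, (MvPolynomial.X v : MvPolynomial V k) ∈ P) :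
    varPrime k A ≤ P := by
  rw [varPrime_eq_span, Ideal.span_le]
  rintro _ ⟨v, hv, rfl⟩
  exact h v (by simpa using hv)

theorem le_height_varPrime {k : Type*} [Field k] {V : Type*} [DecidableEq V] (A : Finset V) :
    (A.card : ℕ∞) ≤ (varPrime k A).height := by
  induction A using Finset.induction_on with
  | empty => simp
  | insert a A ha ih =>
    have hlt : varPrime k A < varPrime k (insert a A) := by
      refine lt_of_le_not_ge (varPrime_le _ _ fun v hv => ?_) fun hle => ha ?_
      · exact (X_mem_varPrime _ _).2 (Finset.mem_insert_of_mem hv)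
      · exact (X_mem_varPrime A a).1 (hle ((X_mem_varPrime _ _).2 (Finset.mem_insert_self a A)))
    have := Ideal.height_add_one_le_of_lt_of_isPrime hlt
    rw [Finset.card_insert_of_notMem ha]
    push_cast
    exact le_trans (by gcongr) this

theorem height_varPrime_le {k : Type*} [Field k] {V : Type*} [Fintype V] [DecidableEq V]
    (A : Finset V) : (varPrime k A).height ≤ A.card := by
  classical
  have h : varPrime k A ∈ (Ideal.span
      ((A.image MvPolynomial.X : Finset (MvPolynomial V k)) : Set (MvPolynomial V k))).minimalPrimes := by
    rw [Finset.coe_image, ← varPrime_eq_span, Ideal.minimalPrimes_eq_subsingleton_self]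
    rfl
  refine (Ideal.height_le_card_of_mem_minimalPrimes_span_finset h).trans ?_
  exact_mod_cast Finset.card_image_le

/-- The height (codimension) of an ideal: the infimum of the heights of the prime ideals
containing it, where the height of a prime is its height in the poset of primes. -/
noncomputable def idealHeight {S : Type*} [CommRing S] (I : Ideal S) : ℕ∞ :=
  ⨅ (P : PrimeSpectrum S) (_ : I ≤ P.asIdeal), Order.height P

/-- Let `F` be a downward-closed family of subsets of a finite set `V` with `V ∉ F`, and
let `I(F)` be the ideal of `k[x_v : v ∈ V]` generated by the squarefree monomials
`x^{V∖A}` for `A ∈ F`. Then for any natural number `m`, `height I(F) ≥ m + 1` iff every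
`A ⊆ V` with `|A| ≤ m` is in `F` (i.e. the fan is `m`-neighborly iff in Cox's GIT
description the unstable locus has codimension at least `m + 1`). -/
theorem stmt_7 {k : Type*} [Field k] {V : Type*} [Fintype V] [DecidableEq V]
    (m : ℕ) (F : Set (Finset V))
    (hdc : ∀ A B : Finset V, B ∈ F → A ⊆ B → A ∈ F)
    (hV : (Finset.univ : Finset V) ∉ F) :
    (m + 1 : ℕ∞) ≤ idealHeight (Ideal.span ((fun B : Finset V =>
        ∏ v ∈ Bᶜ, (MvPolynomial.X v : MvPolynomial V k)) '' F)) ↔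
      ∀ A : Finset V, A.card ≤ m → A ∈ F := by
  constructor
  · intro h A hA
    by_contra hAF
    have hle : Ideal.span ((fun B : Finset V =>
        ∏ v ∈ Bᶜ, (MvPolynomial.X v : MvPolynomial V k)) '' F) ≤ varPrime k A := by
      rw [Ideal.span_le]
      rintro _ ⟨B, hB, rfl⟩
      have : ¬ A ⊆ B := fun hAB => hAF (hdc A B hB hAB)
      obtain ⟨v, hvA, hvB⟩ := Finset.not_subset.1 this
      exact Ideal.mem_of_dvd _ (Finset.dvd_prod_of_mem _ (Finset.mem_compl.2 hvB))
        ((X_mem_varPrime A v).2 hvA)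
    have h1 := h.trans (iInf₂_le (⟨varPrime k A, inferInstance⟩ : PrimeSpectrum _) hle)
    rw [← PrimeSpectrum.height_eq_orderHeight] at h1
    have h2 : ((m + 1 : ℕ) : ℕ∞) ≤ (A.card : ℕ) := by
      push_cast
      exact h1.trans (height_varPrime_le A)
    have h3 : m + 1 ≤ A.card := by exact_mod_cast h2
    omega
  · intro h
    refine le_iInf₂ fun P hP => ?_
    classical
    let A : Finset V := Finset.univ.filter fun v => (MvPolynomial.X v : MvPolynomial V k) ∈ P.asIdeal
    have hA : A ∉ F := by
      intro hAF
      have hm := hP (Ideal.subset_span ⟨A, hAF, rfl⟩)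
      obtain ⟨v, hv, hvP⟩ := (Ideal.IsPrime.prod_mem_iff (hp := P.isPrime)).1 hm
      exact Finset.mem_compl.1 hv (by simpa [A] using hvP)
    have hc : m + 1 ≤ A.card := by
      by_contra hlt
      exact hA (h A (by omega))
    have h1 : varPrime k A ≤ P.asIdeal := varPrime_le _ _ fun v hv => by simpa [A] using hv
    rw [← PrimeSpectrum.height_eq_orderHeight]
    calc (m + 1 : ℕ∞) ≤ (A.card : ℕ∞) := by exact_mod_cast hc
      _ ≤ _ := le_height_varPrime A
      _ ≤ _ := Ideal.height_mono h1
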